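/- (H-theorem.) Let 0 < T* ≤ ∞ and let ρ : [0, T*) → C([−1,1]; ℝ) be a continuously differentiable curve (with respect to the supremum norm) satisfying ∂_t ρ(t,k) = 𝐂[ρ(t)](k) for all t ∈ [0,T*) and k ∈ [−1,1], and assume ρ(t,k) > 0 for all t and k. Then the entropy t ↦ ∫_{−1}^{1} log ρ(t,k) dk is nondecreasing on [0, T*). -/

import Mathlib

open MeasureTheory

/-- Density of the semicircle measure `σ_sc`. -/
noncomputable def scDensity (x : ℝ) : ℝ := (1 / (2 * Real.pi)) * Real.sqrt (max (4 - x ^ 2) 0)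

/-- `ν : [-1,1] → [-2,2]` is the strictly increasing continuous function with
`∫_0^{ν k} dσ_sc = k/2`. -/
def IsNu (ν : ℝ → ℝ) : Prop :=
  (∀ k ∈ Set.Icc (-1 : ℝ) 1, ν k ∈ Set.Icc (-2 : ℝ) 2) ∧
    StrictMonoOn ν (Set.Icc (-1 : ℝ) 1) ∧
      ContinuousOn ν (Set.Icc (-1 : ℝ) 1) ∧
        ∀ k ∈ Set.Icc (-1 : ℝ) 1, (∫ x in (0 : ℝ)..(ν k), scDensity x) = k / 2

/-- `νinv` is an inverse for `ν` on `[-2,2]`. -/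
def IsNuInv (ν νinv : ℝ → ℝ) : Prop :=
  ∀ x ∈ Set.Icc (-2 : ℝ) 2, νinv x ∈ Set.Icc (-1 : ℝ) 1 ∧ ν (νinv x) = x

/-- The collision operator of the kinetic wave equation, with the delta function resolved in the
variable `n = νinv (ν k - ν ℓ + ν m)`. -/
noncomputable def collision (ν νinv : ℝ → ℝ) (ρ : ℝ → ℝ) (k : ℝ) : ℝ :=
  (1 / 2) *
    ∫ p in Set.Icc (-1 : ℝ) 1 ×ˢ Set.Icc (-1 : ℝ) 1,
      (if |ν k - ν p.1 + ν p.2| ≤ 2 then Real.sqrt (4 - (ν k - ν p.1 + ν p.2) ^ 2) else 0) *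
        (ρ p.1 * ρ p.2 * ρ (νinv (ν k - ν p.1 + ν p.2)) -
            ρ k * ρ p.2 * ρ (νinv (ν k - ν p.1 + ν p.2)) +
            ρ k * ρ p.1 * ρ (νinv (ν k - ν p.1 + ν p.2)) -
            ρ k * ρ p.1 * ρ p.2)


/-- semicircle weight -/
noncomputable def scS (x : ℝ) : ℝ := Real.sqrt (4 - x ^ 2)

lemma scS_nonneg (x : ℝ) : 0 ≤ scS x := Real.sqrt_nonneg _
lemma scS_le (x : ℝ) : scS x ≤ 2 := by
  unfold scS
  rw [Real.sqrt_le_left (by norm_num)]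
  nlinarith [sq_nonneg x]
lemma scS_cont : Continuous scS := by unfold scS; fun_prop
lemma scS_zero {x : ℝ} (h : x ∉ Set.Icc (-2 : ℝ) 2) : scS x = 0 := by
  unfold scS
  apply Real.sqrt_eq_zero_of_nonpos
  rw [Set.mem_Icc, not_and_or] at h
  rcases h with h | h <;> nlinarith
lemma scDensity_eq (x : ℝ) : scDensity x = (1 / (2 * Real.pi)) * scS x := by
  unfold scDensity scS
  congr 1
  rcases le_total (4 - x ^ 2) 0 with h | h
  · rw [max_eq_right h, Real.sqrt_zero, Real.sqrt_eq_zero_of_nonpos h]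
  · rw [max_eq_left h]

/-- clamp -/
noncomputable def clampR (a x : ℝ) : ℝ := max (-a) (min a x)
lemma clampR_mem {a : ℝ} (ha : 0 ≤ a) (x : ℝ) : clampR a x ∈ Set.Icc (-a) a := by
  unfold clampR
  exact ⟨le_max_left _ _, max_le (by linarith) (min_le_left _ _)⟩
lemma clampR_of_mem {a x : ℝ} (h : x ∈ Set.Icc (-a) a) : clampR a x = x := by
  unfold clampR
  rw [min_eq_right h.2, max_eq_right h.1]
lemma clampR_cont (a : ℝ) : Continuous (clampR a) := by unfold clampR; fun_prop
lemma clampR_mono (a : ℝ) : Monotone (clampR a) := by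
  intro x y h
  unfold clampR
  gcongr

/-- density in ENNReal -/
noncomputable def scD (x : ℝ) : ENNReal := ENNReal.ofReal (scS x / Real.pi)
lemma scD_meas : Measurable scD := by
  have := scS_cont.measurable
  unfold scD; fun_prop
lemma scD_toReal (x : ℝ) : (scD x).toReal = scS x / Real.pi :=
  ENNReal.toReal_ofReal (div_nonneg (scS_nonneg x) Real.pi_pos.le)

noncomputable def scM : Measure ℝ := volume.withDensity scD

section stat
variable {ν νinv : ℝ → ℝ}

lemma nu_cont (hν : IsNu ν) : Continuous (fun k => ν (clampR 1 k)) :=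
  hν.2.2.1.comp_continuous (clampR_cont 1) (fun x => clampR_mem zero_le_one x)

lemma nuinv_nu (hν : IsNu ν) (hi : IsNuInv ν νinv) {k : ℝ} (hk : k ∈ Set.Icc (-1 : ℝ) 1) :
    νinv (ν k) = k :=
  hν.2.1.injOn (hi _ (hν.1 k hk)).1 hk (hi _ (hν.1 k hk)).2

lemma nu_neg_one (hν : IsNu ν) (hi : IsNuInv ν νinv) : ν (-1) = -2 := by
  have h := hi (-2) (by norm_num)
  have h2 := hν.2.1.monotoneOn (a := -1) (b := νinv (-2)) (by norm_num) h.1 h.1.1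
  have h3 := (hν.1 (-1) (by norm_num)).1
  linarith [h.2]

lemma nu_mp (hν : IsNu ν) (hi : IsNuInv ν νinv) :
    MeasurePreserving (fun k => ν (clampR 1 k)) (volume.restrict (Set.Icc (-1 : ℝ) 1)) scM := by
  have hm := (nu_cont hν).measurable
  refine ⟨hm, ?_⟩
  refine Measure.ext_of_Iic _ _ fun a => ?_
  rw [Measure.map_apply hm measurableSet_Iic, Measure.restrict_apply (hm measurableSet_Iic), scM,
    withDensity_apply _ measurableSet_Iic]
  rcases lt_or_ge a (-2) with ha | ha
  · have h1 : (fun k => ν (clampR 1 k)) ⁻¹' Set.Iic a ∩ Set.Icc (-1 : ℝ) 1 = ∅ := by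
      ext k
      simp only [Set.mem_inter_iff, Set.mem_preimage, Set.mem_Iic, Set.mem_empty_iff_false,
        iff_false, not_and]
      intro h
      have := (hν.1 _ (clampR_mem zero_le_one k)).1
      linarith
    rw [h1, measure_empty, eq_comm]
    rw [← lintegral_indicator measurableSet_Iic]
    rw [lintegral_eq_zero_iff' (scD_meas.indicator measurableSet_Iic).aemeasurable]
    refine Filter.Eventually.of_forall fun x => ?_
    by_cases hx : x ∈ Set.Iic a
    · rw [Set.indicator_of_mem hx]
      unfold scD
      rw [scS_zero]
      · simp
      · intro h; have := h.1; have : x ≤ a := hx; linarith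
    · rw [Set.indicator_of_notMem hx]; rfl
  · set b := min a 2 with hb
    have hb2 : b ∈ Set.Icc (-2 : ℝ) 2 := ⟨le_min ha (by norm_num), min_le_right _ _⟩
    obtain ⟨hc, hcb⟩ := hi b hb2
    set c := νinv b with hcdef
    have h1 : (fun k => ν (clampR 1 k)) ⁻¹' Set.Iic a ∩ Set.Icc (-1 : ℝ) 1 = Set.Icc (-1) c := by
      ext k
      simp only [Set.mem_inter_iff, Set.mem_preimage, Set.mem_Iic, Set.mem_Icc]
      constructor
      · rintro ⟨h, hk⟩
        rw [clampR_of_mem hk] at h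
        refine ⟨hk.1, ?_⟩
        rw [← hν.2.1.le_iff_le hk hc, hcb]
        exact le_min h (hν.1 k hk).2
      · rintro ⟨h, hk⟩
        have hk' : k ∈ Set.Icc (-1 : ℝ) 1 := ⟨h, hk.trans hc.2⟩
        refine ⟨?_, hk'⟩
        rw [clampR_of_mem hk']
        rw [← hν.2.1.le_iff_le hk' hc, hcb] at hk
        exact hk.trans (min_le_left _ _)
    rw [h1, Real.volume_Icc]
    have h2 : ∫⁻ x in Set.Iic a, scD x = ∫⁻ x in Set.Ioc (-2) b, scD x := by
      rw [setLIntegral_congr (Ioc_ae_eq_Icc (a := (-2 : ℝ)) (b := b))]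
      rw [← lintegral_indicator measurableSet_Iic, ← lintegral_indicator measurableSet_Icc]
      congr 1
      ext x
      by_cases hx : x ∈ Set.Icc (-2 : ℝ) 2
      · by_cases hxa : x ≤ a
        · rw [Set.indicator_of_mem (by exact hxa),
            Set.indicator_of_mem (by exact ⟨hx.1, le_min hxa hx.2⟩)]
        · rw [Set.indicator_of_notMem (by exact hxa),
            Set.indicator_of_notMem (by exact fun h => hxa (h.2.trans (min_le_left _ _)))]
      · have : scD x = 0 := by unfold scD; rw [scS_zero hx]; simp
        simp [Set.indicator_apply, this]
    rw [h2]
    unfold scD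
    have hcont : Continuous (fun x => scS x / Real.pi) := scS_cont.div_const _
    rw [← ofReal_integral_eq_lintegral_ofReal
      ((hcont.intervalIntegrable (-2) b).1)
      (Filter.Eventually.of_forall fun x => div_nonneg (scS_nonneg x) Real.pi_pos.le)]
    congr 1
    rw [← intervalIntegral.integral_of_le hb2.1]
    have e1 := hν.2.2.2 c hc
    have e2 := hν.2.2.2 (-1) (by norm_num)
    rw [hcb] at e1
    rw [nu_neg_one hν hi] at e2
    have e3 : ∀ x, scS x / Real.pi = 2 * scDensity x := by
      intro x; rw [scDensity_eq]; field_simp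
    have hI : ∀ u v, IntervalIntegrable scDensity volume u v := by
      intro u v
      have : Continuous scDensity := by
        have : scDensity = fun x => (1 / (2 * Real.pi)) * scS x := funext scDensity_eq
        rw [this]; exact scS_cont.const_mul _
      exact this.intervalIntegrable _ _
    simp_rw [e3]
    rw [intervalIntegral.integral_const_mul]
    have e4 := intervalIntegral.integral_add_adjacent_intervals (hI 0 (-2)) (hI (-2) b)
    linarith

lemma scM_finite (hν : IsNu ν) (hi : IsNuInv ν νinv) : IsFiniteMeasure scM := by
  rw [← (nu_mp hν hi).map_eq]
  infer_instance

end stat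

lemma mp_of_invol {E : Type*} [NormedAddCommGroup E] [NormedSpace ℝ E] [MeasurableSpace E]
    [BorelSpace E] [FiniteDimensional ℝ E] (μ : Measure E) [μ.IsAddHaarMeasure]
    (T : E →ₗ[ℝ] E) (h : ∀ x, T (T x) = x) : MeasurePreserving T μ μ := by
  have h2 : T ∘ₗ T = LinearMap.id := LinearMap.ext h
  have h3 : LinearMap.det T * LinearMap.det T = 1 := by
    rw [← LinearMap.det_comp, h2, LinearMap.det_id]
  have h4 : LinearMap.det T ≠ 0 := by intro h0; rw [h0] at h3; norm_num at h3
  refine ⟨(LinearMap.continuous_of_finiteDimensional T).measurable, ?_⟩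
  rw [Measure.map_linearMap_addHaar_eq_smul_addHaar μ h4]
  have h5 : |(LinearMap.det T)⁻¹| = 1 := by
    rcases mul_self_eq_one_iff.mp h3 with h | h <;> rw [h] <;> norm_num
  rw [h5]; simp

lemma mp_withDensity {α : Type*} [MeasurableSpace α] {μ : Measure α} {T : α → α}
    (hT : MeasurePreserving T μ μ) {d : α → ENNReal} (hd : Measurable d)
    (hdT : ∀ x, d (T x) = d x) :
    MeasurePreserving T (μ.withDensity d) (μ.withDensity d) := by
  refine ⟨hT.measurable, ?_⟩
  ext A hA
  rw [Measure.map_apply hT.measurable hA, withDensity_apply _ (hT.measurable hA),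
    withDensity_apply _ hA, ← hT.setLIntegral_comp_preimage hA hd]
  simp_rw [hdT]

/-- the resonance value -/
def wv (p : ℝ × ℝ × ℝ) : ℝ := p.1 - p.2.1 + p.2.2
lemma wv_meas : Measurable wv := by unfold wv; fun_prop

noncomputable def scW (p : ℝ × ℝ × ℝ) : ENNReal := ENNReal.ofReal (scS (wv p))
lemma scW_meas : Measurable scW := by
  have := scS_cont.measurable
  have := wv_meas
  unfold scW; fun_prop

/-- resonance measure -/
noncomputable def resM : Measure (ℝ × ℝ × ℝ) :=
  (scM.prod (scM.prod scM)).withDensity scW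

lemma resM_eq : resM = (volume : Measure (ℝ × ℝ × ℝ)).withDensity
    (fun p => scD p.1 * (scD p.2.1 * scD p.2.2) * scW p) := by
  have := scD_meas
  have := scW_meas
  unfold resM scM
  rw [prod_withDensity scD_meas scD_meas, prod_withDensity scD_meas (by fun_prop)]
  rw [← withDensity_mul _ (by fun_prop) scW_meas]
  rfl

/-- swap x and z -/
def swapXZ : (ℝ × ℝ × ℝ) →ₗ[ℝ] (ℝ × ℝ × ℝ) where
  toFun p := (p.2.2, p.2.1, p.1)
  map_add' _ _ := rfl
  map_smul' _ _ := rfl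

/-- swap x with y and z with w -/
def swapXY : (ℝ × ℝ × ℝ) →ₗ[ℝ] (ℝ × ℝ × ℝ) where
  toFun p := (p.2.1, p.1, p.1 - p.2.1 + p.2.2)
  map_add' a b := by
    ext <;> simp <;> ring
  map_smul' a b := by
    ext <;> simp <;> ring

lemma resD_meas : Measurable (fun p : ℝ × ℝ × ℝ => scD p.1 * (scD p.2.1 * scD p.2.2) * scW p) := by
  have := scD_meas
  have := scW_meas
  fun_prop

lemma haar3 : (volume : Measure (ℝ × ℝ × ℝ)).IsAddHaarMeasure := by
  have h : (volume : Measure (ℝ × ℝ)).IsAddHaarMeasure :=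
    inferInstanceAs (((volume : Measure ℝ).prod (volume : Measure ℝ)).IsAddHaarMeasure)
  exact inferInstanceAs
    (((volume : Measure ℝ).prod (volume : Measure (ℝ × ℝ))).IsAddHaarMeasure)

lemma swapXZ_mp : MeasurePreserving swapXZ resM resM := by
  rw [resM_eq]
  have := haar3
  refine mp_withDensity (mp_of_invol _ _ (fun x => rfl)) resD_meas ?_
  intro p
  have : wv (swapXZ p) = wv p := by simp [wv, swapXZ]; ring
  simp only [scW, this]
  simp only [swapXZ, LinearMap.coe_mk, AddHom.coe_mk]
  ring

lemma swapXY_mp : MeasurePreserving swapXY resM resM := by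
  rw [resM_eq]
  have := haar3
  refine mp_withDensity (mp_of_invol _ _ (fun x => by
    ext <;> simp only [swapXY, LinearMap.coe_mk, AddHom.coe_mk]; ring)) resD_meas ?_
  intro p
  have : wv (swapXY p) = p.2.2 := by simp only [wv, swapXY, LinearMap.coe_mk, AddHom.coe_mk]; ring
  simp only [scW, this]
  have h2 : ∀ x, ENNReal.ofReal (scS x) = ENNReal.ofReal Real.pi * scD x := by
    intro x
    unfold scD
    rw [← ENNReal.ofReal_mul Real.pi_pos.le]
    congr 1
    field_simp
  simp only [h2, wv, swapXY, LinearMap.coe_mk, AddHom.coe_mk]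
  ring

/-- the cubic polynomial -/
def cubP (a b c d : ℝ) : ℝ := b * c * d - a * c * d + a * b * d - a * b * c

lemma cubP_bound {R a b c d : ℝ} (ha : 0 ≤ a) (hb : 0 ≤ b) (hc : 0 ≤ c) (hd : 0 ≤ d)
    (ha' : a ≤ R) (hb' : b ≤ R) (hc' : c ≤ R) (hd' : d ≤ R) : |cubP a b c d| ≤ 2 * R ^ 3 := by
  have key : ∀ u v w : ℝ, 0 ≤ u → 0 ≤ v → 0 ≤ w → u ≤ R → v ≤ R → w ≤ R →
      0 ≤ u * v * w ∧ u * v * w ≤ R ^ 3 := by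
    intro u v w hu hv hw hu' hv' hw'
    refine ⟨by positivity, ?_⟩
    have hR : 0 ≤ R := hu.trans hu'
    calc u * v * w ≤ R * R * R := by gcongr
      _ = R ^ 3 := by ring
  have h1 := key b c d hb hc hd hb' hc' hd'
  have h2 := key a c d ha hc hd ha' hc' hd'
  have h3 := key a b d ha hb hd ha' hb' hd'
  have h4 := key a b c ha hb hc ha' hb' hc'
  unfold cubP
  rw [abs_le]
  constructor <;> linarith [h1.1, h1.2, h2.1, h2.2, h3.1, h3.2, h4.1, h4.2]

/-- the integrand on the resonance manifold -/
def cubF (f : ℝ → ℝ) (p : ℝ × ℝ × ℝ) : ℝ := cubP (f p.1) (f p.2.1) (f p.2.2) (f (wv p))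

lemma cubF_meas {f : ℝ → ℝ} (hf : Measurable f) : Measurable (cubF f) := by
  have := wv_meas
  unfold cubF cubP
  fun_prop

lemma resM_finite [IsFiniteMeasure scM] : IsFiniteMeasure resM := by
  unfold resM
  refine isFiniteMeasure_withDensity ?_
  have : ∀ p, scW p ≤ 2 := by
    intro p
    unfold scW
    calc _ ≤ ENNReal.ofReal 2 := ENNReal.ofReal_le_ofReal (scS_le _)
      _ = 2 := by simp
  refine ne_of_lt ((lintegral_mono this).trans_lt ?_)
  rw [lintegral_const]
  exact ENNReal.mul_lt_top (by simp) (measure_lt_top _ _)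

section sym
variable [IsFiniteMeasure scM] {f φ : ℝ → ℝ} {r R C : ℝ}

lemma sym_int (hf : Measurable f) (hφ : Measurable φ) (hr : ∀ x, 0 ≤ f x) (hR : ∀ x, f x ≤ R)
    (hC : ∀ x, |φ x| ≤ C) (u : ℝ × ℝ × ℝ → ℝ) (hu : Measurable u) :
    Integrable (fun p => φ (u p) * cubF f p) resM := by
  have := resM_finite
  have := cubF_meas hf
  refine Integrable.of_bound (Measurable.aestronglyMeasurable (by fun_prop)) (C * (2 * R ^ 3))
    (Filter.Eventually.of_forall fun p => ?_)
  rw [Real.norm_eq_abs, abs_mul]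
  gcongr
  · exact (abs_nonneg _).trans (hC 0)
  · exact hC _
  · exact cubP_bound (hr _) (hr _) (hr _) (hr _) (hR _) (hR _) (hR _) (hR _)

lemma sym_XZ (hf : Measurable f) (hφ : Measurable φ) :
    ∫ p, φ p.2.2 * cubF f p ∂resM = ∫ p, φ p.1 * cubF f p ∂resM := by
  have h0 := cubF_meas hf
  conv_rhs => rw [← swapXZ_mp.map_eq]
  rw [integral_map swapXZ_mp.measurable.aemeasurable
    (Measurable.aestronglyMeasurable (by fun_prop))]
  congr 1
  ext p
  have : wv (swapXZ p) = wv p := by simp [wv, swapXZ]; ring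
  unfold cubF
  rw [this]
  simp only [swapXZ, LinearMap.coe_mk, AddHom.coe_mk, cubP]
  ring

lemma sym_XY (hf : Measurable f) (hφ : Measurable φ) :
    ∫ p, φ p.2.1 * cubF f p ∂resM = - ∫ p, φ p.1 * cubF f p ∂resM := by
  have h0 := cubF_meas hf
  conv_rhs => rw [← swapXY_mp.map_eq]
  rw [integral_map swapXY_mp.measurable.aemeasurable
    (Measurable.aestronglyMeasurable (by fun_prop)), ← integral_neg]
  congr 1
  ext p
  have : wv (swapXY p) = p.2.2 := by simp only [wv, swapXY, LinearMap.coe_mk, AddHom.coe_mk]; ring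
  unfold cubF
  rw [this]
  simp only [swapXY, LinearMap.coe_mk, AddHom.coe_mk, cubP, wv]
  ring

lemma sym_ZW (hf : Measurable f) (hφ : Measurable φ) :
    ∫ p, φ (wv p) * cubF f p ∂resM = - ∫ p, φ p.2.2 * cubF f p ∂resM := by
  have h0 := cubF_meas hf
  conv_rhs => rw [← swapXY_mp.map_eq]
  rw [integral_map swapXY_mp.measurable.aemeasurable
    (Measurable.aestronglyMeasurable (by fun_prop)), ← integral_neg]
  congr 1
  ext p
  have : wv (swapXY p) = p.2.2 := by simp only [wv, swapXY, LinearMap.coe_mk, AddHom.coe_mk]; ring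
  unfold cubF
  rw [this]
  simp only [swapXY, LinearMap.coe_mk, AddHom.coe_mk, cubP, wv]
  ring

lemma sym_mass (hf : Measurable f) : ∫ p, cubF f p ∂resM = 0 := by
  have := sym_XY (φ := fun _ => 1) hf measurable_const
  simp only [one_mul] at this
  linarith

lemma sym_entropy (hf : Measurable f) (hr0 : 0 < r) (hr : ∀ x, r ≤ f x) (hR : ∀ x, f x ≤ R) :
    0 ≤ ∫ p, (f p.1)⁻¹ * cubF f p ∂resM := by
  have hφ : Measurable (fun x => (f x)⁻¹) := hf.inv
  have hf0 : ∀ x, 0 < f x := fun x => hr0.trans_le (hr x)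
  have hC : ∀ x, |(f x)⁻¹| ≤ r⁻¹ := by
    intro x
    rw [abs_of_pos (inv_pos.mpr (hf0 x))]
    exact inv_anti₀ hr0 (hr x)
  have hI := sym_int hf hφ (fun x => (hf0 x).le) hR hC
  have i1 := hI (fun p => p.1) (by fun_prop)
  have i2 := hI (fun p => p.2.1) (by fun_prop)
  have i3 := hI (fun p => p.2.2) (by fun_prop)
  have i4 := hI wv wv_meas
  have e1 := sym_XZ hf hφ
  have e2 := sym_XY hf hφ
  have e3 := sym_ZW hf hφ
  have hpos : 0 ≤ ∫ p, ((f p.1)⁻¹ * cubF f p - (f p.2.1)⁻¹ * cubF f p) +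
      ((f p.2.2)⁻¹ * cubF f p - (f (wv p))⁻¹ * cubF f p) ∂resM := by
    refine integral_nonneg fun p => ?_
    have h1 := hf0 p.1
    have h2 := hf0 p.2.1
    have h3 := hf0 p.2.2
    have h4 := hf0 (wv p)
    unfold cubF cubP
    generalize f p.1 = a at *
    generalize f p.2.1 = b at *
    generalize f p.2.2 = c at *
    generalize f (wv p) = d at *
    have : a⁻¹ * (b * c * d - a * c * d + a * b * d - a * b * c)
        - b⁻¹ * (b * c * d - a * c * d + a * b * d - a * b * c)
        + (c⁻¹ * (b * c * d - a * c * d + a * b * d - a * b * c)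
        - d⁻¹ * (b * c * d - a * c * d + a * b * d - a * b * c))
        = a * b * c * d * (a⁻¹ - b⁻¹ + c⁻¹ - d⁻¹) ^ 2 := by
      field_simp
      ring
    show 0 ≤ _
    rw [this]
    positivity
  rw [integral_add (by exact i1.sub i2) (by exact i3.sub i4), integral_sub i1 i2, integral_sub i3 i4] at hpos
  linarith
end sym

section coll
variable {ν νinv : ℝ → ℝ} {ρ : ℝ → ℝ}

/-- the profile in the frequency variable -/
noncomputable def prof (νinv ρ : ℝ → ℝ) (x : ℝ) : ℝ := ρ (clampR 1 (νinv (clampR 2 x)))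

lemma prof_meas (hν : IsNu ν) (hi : IsNuInv ν νinv)
    (hρ : ContinuousOn ρ (Set.Icc (-1 : ℝ) 1)) : Measurable (prof νinv ρ) := by
  have h1 : Measurable (fun k => ρ (clampR 1 k)) :=
    (hρ.comp_continuous (clampR_cont 1) (fun x => clampR_mem zero_le_one x)).measurable
  have h2 : Monotone (fun x => νinv (clampR 2 x)) := by
    intro x y hxy
    have hx := hi _ (clampR_mem zero_le_two x)
    have hy := hi _ (clampR_mem zero_le_two y)
    show νinv _ ≤ νinv _
    rw [← hν.2.1.le_iff_le hx.1 hy.1, hx.2, hy.2]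
    exact clampR_mono 2 hxy
  exact h1.comp h2.measurable

lemma prof_nu (hν : IsNu ν) (hi : IsNuInv ν νinv) {k : ℝ} (hk : k ∈ Set.Icc (-1 : ℝ) 1) :
    prof νinv ρ (ν k) = ρ k := by
  unfold prof
  rw [clampR_of_mem (hν.1 k hk), nuinv_nu hν hi hk, clampR_of_mem hk]

lemma prof_eq (hi : IsNuInv ν νinv) {x : ℝ} (hx : x ∈ Set.Icc (-2 : ℝ) 2) :
    prof νinv ρ x = ρ (νinv x) := by
  unfold prof
  rw [clampR_of_mem hx, clampR_of_mem (hi x hx).1]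

lemma int_nu (hν : IsNu ν) (hi : IsNuInv ν νinv) {Ψ : ℝ → ℝ} (hΨ : Measurable Ψ) :
    ∫ k in Set.Icc (-1 : ℝ) 1, Ψ (ν k) = ∫ x, Ψ x ∂scM := by
  rw [← (nu_mp hν hi).map_eq, integral_map (nu_mp hν hi).measurable.aemeasurable
    hΨ.aestronglyMeasurable]
  refine setIntegral_congr_fun measurableSet_Icc fun k hk => ?_
  simp only [clampR_of_mem hk]

lemma mass_eq (hν : IsNu ν) (hi : IsNuInv ν νinv)
    (hρ : ContinuousOn ρ (Set.Icc (-1 : ℝ) 1)) :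
    ∫ k in Set.Icc (-1 : ℝ) 1, ρ k = ∫ x, prof νinv ρ x ∂scM := by
  rw [← int_nu hν hi (prof_meas hν hi hρ)]
  exact setIntegral_congr_fun measurableSet_Icc fun k hk => (prof_nu hν hi hk).symm

lemma coll_eq (hν : IsNu ν) (hi : IsNuInv ν νinv)
    (hρ : ContinuousOn ρ (Set.Icc (-1 : ℝ) 1)) {k : ℝ} (hk : k ∈ Set.Icc (-1 : ℝ) 1) :
    collision ν νinv ρ k = (1 / 2) * ∫ p : ℝ × ℝ, scS (wv (ν k, p)) *
      cubF (prof νinv ρ) (ν k, p) ∂(scM.prod scM) := by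
  have hm := (nu_mp hν hi).prod (nu_mp hν hi)
  have h0 := cubF_meas (prof_meas hν hi hρ)
  have h1 := scS_cont.measurable
  have h2 := wv_meas
  rw [← hm.map_eq, integral_map hm.measurable.aemeasurable
    (Measurable.aestronglyMeasurable (by fun_prop))]
  rw [Measure.prod_restrict, collision]
  congr 1
  refine setIntegral_congr_fun (measurableSet_Icc.prod measurableSet_Icc) fun p hp => ?_
  obtain ⟨hp1, hp2⟩ := hp
  simp only [Prod.map, clampR_of_mem hp1, clampR_of_mem hp2, cubF, wv, prof_nu hν hi hp1,
    prof_nu hν hi hp2, prof_nu hν hi hk]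
  split_ifs with h
  · rw [prof_eq hi (abs_le.mp h)]
    rfl
  · rw [scS_zero (fun h' => h (abs_le.mpr h'))]
    simp

lemma coll_phi (hν : IsNu ν) (hi : IsNuInv ν νinv)
    (hρ : ContinuousOn ρ (Set.Icc (-1 : ℝ) 1)) {R C : ℝ} (h0 : ∀ x, 0 ≤ prof νinv ρ x)
    (hR : ∀ x, prof νinv ρ x ≤ R) {φ : ℝ → ℝ} (hφ : Measurable φ) (hC : ∀ x, |φ x| ≤ C) :
    ∫ k in Set.Icc (-1 : ℝ) 1, φ (ν k) * collision ν νinv ρ k =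
      (1 / 2) * ∫ p, φ p.1 * cubF (prof νinv ρ) p ∂resM := by
  have := scM_finite hν hi
  have hf := prof_meas hν hi hρ
  have hcm := cubF_meas hf
  have h1 := scS_cont.measurable
  have h2 := wv_meas
  have hmeas : Measurable (fun p => scS (wv p) * cubF (prof νinv ρ) p) := by fun_prop
  have e1 : ∫ k in Set.Icc (-1 : ℝ) 1, φ (ν k) * collision ν νinv ρ k =
      ∫ x, φ x * ((1 / 2) * ∫ p : ℝ × ℝ, scS (wv (x, p)) *
      cubF (prof νinv ρ) (x, p) ∂(scM.prod scM)) ∂scM := by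
    rw [← int_nu hν hi]
    · refine setIntegral_congr_fun measurableSet_Icc fun k hk => ?_
      simp only [coll_eq hν hi hρ hk]
    · have := (hmeas.stronglyMeasurable.integral_prod_right' (ν := scM.prod scM)).measurable
      exact hφ.mul (this.const_mul _)
  rw [e1]
  have hI : Integrable (fun p : ℝ × ℝ × ℝ => φ p.1 * (scS (wv p) * cubF (prof νinv ρ) p))
      (scM.prod (scM.prod scM)) := by
    refine Integrable.of_bound (Measurable.aestronglyMeasurable (by fun_prop))
      (C * (2 * (2 * R ^ 3))) (Filter.Eventually.of_forall fun p => ?_)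
    rw [Real.norm_eq_abs, abs_mul, abs_mul]
    gcongr
    · exact (abs_nonneg _).trans (hC 0)
    · exact hC _
    · rw [abs_of_nonneg (scS_nonneg _)]; exact scS_le _
    · exact cubP_bound (h0 _) (h0 _) (h0 _) (h0 _) (hR _) (hR _) (hR _) (hR _)
  have e2 : ∫ p, φ p.1 * cubF (prof νinv ρ) p ∂resM =
      ∫ p : ℝ × ℝ × ℝ, φ p.1 * (scS (wv p) * cubF (prof νinv ρ) p)
        ∂(scM.prod (scM.prod scM)) := by
    unfold resM
    rw [integral_withDensity_eq_integral_toReal_smul scW_meas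
      (Filter.Eventually.of_forall fun p => by simp [scW])]
    congr 1
    ext p
    rw [scW, ENNReal.toReal_ofReal (scS_nonneg _), smul_eq_mul]
    ring
  rw [e2, integral_prod _ hI, ← integral_const_mul]
  congr 1
  ext x
  show _ = 1 / 2 * ∫ y : ℝ × ℝ, φ x * (scS (wv (x, y)) * cubF (prof νinv ρ) (x, y)) ∂scM.prod scM
  rw [integral_const_mul]
  ring

lemma coll_bounds {a b : ℝ}
    (h : ∀ k ∈ Set.Icc (-1 : ℝ) 1, a ≤ ρ k ∧ ρ k ≤ b) (x : ℝ) :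
    a ≤ prof νinv ρ x ∧ prof νinv ρ x ≤ b :=
  h _ (clampR_mem zero_le_one _)

/-- mass conservation, static form -/
lemma coll_mass (hν : IsNu ν) (hi : IsNuInv ν νinv)
    (hρ : ContinuousOn ρ (Set.Icc (-1 : ℝ) 1)) {r R : ℝ} (hr : 0 < r)
    (h : ∀ k ∈ Set.Icc (-1 : ℝ) 1, r ≤ ρ k ∧ ρ k ≤ R) :
    ∫ k in Set.Icc (-1 : ℝ) 1, collision ν νinv ρ k = 0 := by
  have hb := coll_bounds (νinv := νinv) h
  have := scM_finite hν hi
  have e := coll_phi hν hi hρ (R := R) (C := 1) (φ := fun _ => 1)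
    (fun x => hr.le.trans (hb x).1) (fun x => (hb x).2) measurable_const (by simp)
  simp only [one_mul] at e
  rw [e, sym_mass (prof_meas hν hi hρ), mul_zero]

/-- entropy production, static form -/
lemma coll_entropy (hν : IsNu ν) (hi : IsNuInv ν νinv)
    (hρ : ContinuousOn ρ (Set.Icc (-1 : ℝ) 1)) {r R : ℝ} (hr : 0 < r)
    (h : ∀ k ∈ Set.Icc (-1 : ℝ) 1, r ≤ ρ k ∧ ρ k ≤ R) :
    0 ≤ ∫ k in Set.Icc (-1 : ℝ) 1, collision ν νinv ρ k / ρ k := by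
  have hb := coll_bounds (νinv := νinv) h
  have := scM_finite hν hi
  have hf := prof_meas hν hi hρ
  have e := coll_phi hν hi hρ (R := R) (C := r⁻¹) (φ := fun x => (prof νinv ρ x)⁻¹)
    (fun x => hr.le.trans (hb x).1) (fun x => (hb x).2) hf.inv (by
      intro x
      rw [abs_of_pos (inv_pos.mpr (hr.trans_le (hb x).1))]
      exact inv_anti₀ hr (hb x).1)
  have e2 : ∫ k in Set.Icc (-1 : ℝ) 1, collision ν νinv ρ k / ρ k =
      ∫ k in Set.Icc (-1 : ℝ) 1, (prof νinv ρ (ν k))⁻¹ * collision ν νinv ρ k := by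
    refine setIntegral_congr_fun measurableSet_Icc fun k hk => ?_
    simp only [prof_nu hν hi hk]
    rw [div_eq_inv_mul]
  rw [e2, e]
  have := sym_entropy hf hr (fun x => (hb x).1) (fun x => (hb x).2)
  positivity

lemma coll_abs (hν : IsNu ν) (hi : IsNuInv ν νinv)
    (hρ : ContinuousOn ρ (Set.Icc (-1 : ℝ) 1)) {R : ℝ}
    (h : ∀ k ∈ Set.Icc (-1 : ℝ) 1, 0 ≤ ρ k ∧ ρ k ≤ R) {k : ℝ} (hk : k ∈ Set.Icc (-1 : ℝ) 1) :
    |collision ν νinv ρ k| ≤ (1 / 2) * (2 * (2 * R ^ 3) * (scM.prod scM).real Set.univ) := by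
  have hb := coll_bounds (νinv := νinv) h
  have := scM_finite hν hi
  rw [coll_eq hν hi hρ hk, abs_mul, abs_of_pos (by norm_num : (0 : ℝ) < 1 / 2)]
  refine mul_le_mul_of_nonneg_left ?_ (by norm_num)
  rw [← Real.norm_eq_abs]
  refine norm_integral_le_of_norm_le_const (Filter.Eventually.of_forall fun p => ?_)
  rw [Real.norm_eq_abs, abs_mul]
  gcongr
  · rw [abs_of_nonneg (scS_nonneg _)]; exact scS_le _
  · exact cubP_bound (hb _).1 (hb _).1 (hb _).1 (hb _).1 (hb _).2 (hb _).2 (hb _).2 (hb _).2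

/-- main convolution estimate -/
lemma conv_est [IsFiniteMeasure scM] {f : ℝ → ℝ} (hf : Measurable f) {R : ℝ}
    (h0 : ∀ x, 0 ≤ f x) (hR : ∀ x, f x ≤ R) (c : ℝ) :
    ∫ y, scS (c - y) * f (c - y) ∂scM ≤ 2 * ∫ x, f x ∂scM := by
  have h1 := scS_cont.measurable
  have e : ∀ g : ℝ → ℝ, ∫ y, g y ∂scM = ∫ y, scS y / Real.pi * g y := by
    intro g
    unfold scM
    rw [integral_withDensity_eq_integral_toReal_smul scD_meas
      (Filter.Eventually.of_forall fun p => by simp [scD])]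
    simp only [scD_toReal, smul_eq_mul]
  have hif : Integrable f scM := Integrable.of_bound hf.aestronglyMeasurable R
    (Filter.Eventually.of_forall fun x => by
      rw [Real.norm_eq_abs, abs_of_nonneg (h0 x)]; exact hR x)
  have hif2 : Integrable (fun y => scS y / Real.pi * f y) volume := by
    unfold scM at hif
    rw [integrable_withDensity_iff scD_meas
      (Filter.Eventually.of_forall fun p => by simp [scD])] at hif
    simpa only [scD_toReal, mul_comm] using hif
  rw [e, e]
  have hz : ∫ y, 2 * (scS (c - y) / Real.pi * f (c - y)) = 2 * ∫ y, scS y / Real.pi * f y := by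
    rw [integral_const_mul, integral_sub_left_eq_self (fun y => scS y / Real.pi * f y) volume c]
  rw [← hz]
  refine integral_mono_of_nonneg (Filter.Eventually.of_forall fun y => ?_)
    ((hif2.comp_sub_left c).const_mul 2) (Filter.Eventually.of_forall fun y => ?_)
  · have := scS_nonneg y
    have := scS_nonneg (c - y)
    have := h0 (c - y)
    have := Real.pi_pos
    show 0 ≤ _
    positivity
  · show scS y / Real.pi * (scS (c - y) * f (c - y)) ≤ 2 * (scS (c - y) / Real.pi * f (c - y))
    have h3 : 0 ≤ scS (c - y) / Real.pi * f (c - y) :=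
      mul_nonneg (div_nonneg (scS_nonneg _) Real.pi_pos.le) (h0 _)
    calc _ = scS y * (scS (c - y) / Real.pi * f (c - y)) := by ring
      _ ≤ _ := mul_le_mul_of_nonneg_right (scS_le y) h3

lemma coll_lower (hν : IsNu ν) (hi : IsNuInv ν νinv)
    (hρ : ContinuousOn ρ (Set.Icc (-1 : ℝ) 1)) {R : ℝ}
    (h : ∀ k ∈ Set.Icc (-1 : ℝ) 1, 0 ≤ ρ k ∧ ρ k ≤ R) {k : ℝ} (hk : k ∈ Set.Icc (-1 : ℝ) 1) :
    - (2 * (∫ l in Set.Icc (-1 : ℝ) 1, ρ l) ^ 2) * ρ k ≤ collision ν νinv ρ k := by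
  have hb := coll_bounds (νinv := νinv) h
  have := scM_finite hν hi
  have hf := prof_meas hν hi hρ
  rw [coll_eq hν hi hρ hk, mass_eq hν hi hρ, ← prof_nu hν hi hk (ρ := ρ)]
  generalize prof νinv ρ = f at *
  generalize ν k = x
  have h1 := scS_cont.measurable
  have h2 := wv_meas
  have hcm := cubF_meas hf
  have hif : Integrable f scM := Integrable.of_bound hf.aestronglyMeasurable R
    (Filter.Eventually.of_forall fun x => by
      rw [Real.norm_eq_abs, abs_of_nonneg (hb x).1]; exact (hb x).2)
  have hR0 : 0 ≤ R := (hb 0).1.trans (hb 0).2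
  -- the two loss terms
  set L1 : ℝ × ℝ → ℝ := fun p => f p.2 * (scS (x - p.1 + p.2) * f (x - p.1 + p.2)) with hL1
  set L2 : ℝ × ℝ → ℝ := fun p => 2 * (f p.1 * f p.2) with hL2
  have iL1 : Integrable L1 (scM.prod scM) := by
    refine Integrable.of_bound (Measurable.aestronglyMeasurable (by fun_prop))
      (R * (2 * R)) (Filter.Eventually.of_forall fun p => ?_)
    simp only [hL1]
    rw [Real.norm_eq_abs, abs_mul, abs_mul, abs_of_nonneg (hb _).1, abs_of_nonneg (hb _).1,
      abs_of_nonneg (scS_nonneg _)]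
    have := scS_le (x - p.1 + p.2)
    have := (hb p.2)
    have := hb (x - p.1 + p.2)
    have h4 : scS (x - p.1 + p.2) * f (x - p.1 + p.2) ≤ 2 * R :=
      mul_le_mul (scS_le _) (hb _).2 (hb _).1 (by norm_num)
    exact mul_le_mul (hb _).2 h4 (mul_nonneg (scS_nonneg _) (hb _).1) hR0
  have iL2 : Integrable L2 (scM.prod scM) := (hif.mul_prod hif).const_mul 2
  have bL1 : ∫ p, L1 p ∂(scM.prod scM) ≤ 2 * (∫ y, f y ∂scM) ^ 2 := by
    rw [integral_prod_symm _ iL1]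
    simp only [hL1]
    simp_rw [integral_const_mul]
    have : ∀ z, ∫ y, scS (x - y + z) * f (x - y + z) ∂scM ≤ 2 * ∫ x, f x ∂scM := by
      intro z
      have := conv_est hf (fun x => (hb x).1) (fun x => (hb x).2) (x + z)
      have e : ∀ y, x + z - y = x - y + z := fun y => by ring
      simpa only [e] using this
    calc _ ≤ ∫ z, f z * (2 * ∫ x, f x ∂scM) ∂scM := by
          refine integral_mono_of_nonneg (Filter.Eventually.of_forall fun z => ?_)
            (hif.mul_const _) (Filter.Eventually.of_forall fun z => ?_)
          · exact mul_nonneg (hb z).1 (integral_nonneg fun y =>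
              mul_nonneg (scS_nonneg _) (hb _).1)
          · exact mul_le_mul_of_nonneg_left (this z) (hb z).1
      _ = _ := by rw [integral_mul_const]; ring
  have bL2 : ∫ p, L2 p ∂(scM.prod scM) = 2 * (∫ y, f y ∂scM) ^ 2 := by
    simp only [hL2]
    rw [integral_const_mul, integral_prod_mul]
    ring
  have key : - (f x * ∫ p, (L1 p + L2 p) ∂(scM.prod scM)) ≤
      ∫ p : ℝ × ℝ, scS (wv (x, p)) * cubF f (x, p) ∂(scM.prod scM) := by
    rw [← integral_const_mul, ← integral_neg]
    refine integral_mono ((iL1.add iL2).const_mul _).neg ?_ fun p => ?_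
    · refine Integrable.of_bound (Measurable.aestronglyMeasurable (by fun_prop))
        (2 * (2 * R ^ 3)) (Filter.Eventually.of_forall fun p => ?_)
      rw [Real.norm_eq_abs, abs_mul]
      gcongr
      · rw [abs_of_nonneg (scS_nonneg _)]; exact scS_le _
      · exact cubP_bound (hb _).1 (hb _).1 (hb _).1 (hb _).1 (hb _).2 (hb _).2 (hb _).2 (hb _).2
    · simp only [hL1, hL2, cubF, cubP, wv]
      have q1 := scS_nonneg (x - p.1 + p.2)
      have q2 := scS_le (x - p.1 + p.2)
      have a1 := (hb x).1
      have a2 := (hb p.1).1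
      have a3 := (hb p.2).1
      have a4 := (hb (x - p.1 + p.2)).1
      generalize scS (x - p.1 + p.2) = S at *
      generalize f x = a at *
      generalize f p.1 = b at *
      generalize f p.2 = c at *
      generalize f (x - p.1 + p.2) = d at *
      have t1 : 0 ≤ S * (b * c * d) := by positivity
      have t2 : 0 ≤ S * (a * b * d) := by positivity
      have t3 : 0 ≤ (2 - S) * (a * b * c) := mul_nonneg (by linarith) (by positivity)
      nlinarith
  rw [integral_add iL1 iL2, bL2] at key
  have := mul_le_mul_of_nonneg_left bL1 (hb x).1
  nlinarith
end coll

section gen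
open Set Filter Topology

lemma int_mono_gen {p q : ℝ} (hpq : p ≤ q) {F F' : ℝ → ℝ → ℝ} {C : ℝ}
    (hc : ∀ t ∈ Icc p q, ContinuousOn (F t) (Icc (-1 : ℝ) 1))
    (hd : ∀ t ∈ Icc p q, ∀ k ∈ Icc (-1 : ℝ) 1,
      HasDerivWithinAt (fun s => F s k) (F' t k) (Icc p q) t)
    (hC : ∀ t ∈ Icc p q, ∀ k ∈ Icc (-1 : ℝ) 1, |F' t k| ≤ C)
    (h0 : ∀ t ∈ Icc p q, 0 ≤ ∫ k in Icc (-1 : ℝ) 1, F' t k) :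
    ∫ k in Icc (-1 : ℝ) 1, F p k ≤ ∫ k in Icc (-1 : ℝ) 1, F q k := by
  have hI : ∀ t ∈ Icc p q, IntegrableOn (F t) (Icc (-1 : ℝ) 1) :=
    fun t ht => (hc t ht).integrableOn_compact isCompact_Icc
  have hlip : ∀ s ∈ Icc p q, ∀ t ∈ Icc p q, ∀ k ∈ Icc (-1 : ℝ) 1,
      |F t k - F s k| ≤ C * |t - s| := by
    intro s hs t ht k hk
    exact (convex_Icc p q).norm_image_sub_le_of_norm_hasDerivWithin_le
      (fun x hx => hd x hx k hk) (fun x hx => hC x hx k hk) hs ht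
  have hder : ∀ t ∈ Ioo p q, HasDerivAt (fun s => ∫ k in Icc (-1 : ℝ) 1, F s k)
      (∫ k in Icc (-1 : ℝ) 1, F' t k) t := by
    intro t ht
    have htI := Ioo_subset_Icc_self ht
    have hat : ∀ x ∈ Ioo p q, ∀ k ∈ Icc (-1 : ℝ) 1, HasDerivAt (fun s => F s k) (F' x k) x :=
      fun x hx k hk => (hd x (Ioo_subset_Icc_self hx) k hk).hasDerivAt (Icc_mem_nhds hx.1 hx.2)
    have hmeas : AEStronglyMeasurable (F' t) (volume.restrict (Icc (-1 : ℝ) 1)) := by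
      set u : ℕ → ℝ := fun n => t + (q - t) * (1 / ((n : ℝ) + 1)) with hu
      have hqt : 0 < q - t := sub_pos.mpr ht.2
      have hu1 : Tendsto u atTop (𝓝[≠] t) := by
        refine tendsto_nhdsWithin_iff.mpr ⟨?_, Eventually.of_forall fun n => ?_⟩
        · have := (tendsto_one_div_add_atTop_nhds_zero_nat (𝕜 := ℝ)).const_mul (q - t)
          have := this.const_add t
          simpa [hu] using this
        · have : 0 < (q - t) * (1 / ((n : ℝ) + 1)) := by positivity
          simp only [hu, mem_compl_iff, mem_singleton_iff]
          linarith
      have hu2 : ∀ n, u n ∈ Icc p q := by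
        intro n
        have h1 : 0 < (1 / ((n : ℝ) + 1)) := by positivity
        have h2 : (1 / ((n : ℝ) + 1)) ≤ 1 := by
          rw [div_le_one (by positivity)]
          have : (0 : ℝ) ≤ n := by positivity
          linarith
        constructor
        · have : 0 < (q - t) * (1 / ((n : ℝ) + 1)) := by positivity
          simp only [hu]; linarith [htI.1]
        · simp only [hu]; nlinarith
      refine aestronglyMeasurable_of_tendsto_ae atTop
        (f := fun n k => (u n - t)⁻¹ * (F (u n) k - F t k)) (fun n => ?_) ?_
      · exact (((hI _ (hu2 n)).sub (hI t htI)).const_mul _).aestronglyMeasurable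
      · filter_upwards [ae_restrict_mem measurableSet_Icc] with k hk
        have := ((hat t ht k hk).tendsto_slope).comp hu1
        simpa [slope_def_field, Function.comp_def, div_eq_inv_mul] using this
    refine (hasDerivAt_integral_of_dominated_loc_of_deriv_le (s := Ioo p q)
      (bound := fun _ => C) (Ioo_mem_nhds ht.1 ht.2) ?_ (hI t htI) hmeas ?_ ?_ ?_).2
    · filter_upwards [Ioo_mem_nhds ht.1 ht.2] with x hx
      exact (hI x (Ioo_subset_Icc_self hx)).aestronglyMeasurable
    · filter_upwards [ae_restrict_mem measurableSet_Icc] with k hk x hx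
      exact hC x (Ioo_subset_Icc_self hx) k hk
    · exact integrable_const _
    · filter_upwards [ae_restrict_mem measurableSet_Icc] with k hk x hx
      exact hat x hx k hk
  have hcont : ContinuousOn (fun s => ∫ k in Icc (-1 : ℝ) 1, F s k) (Icc p q) := by
    refine continuousOn_of_dominated (bound := fun k => |F p k| + C * (q - p))
      (fun x hx => (hI x hx).aestronglyMeasurable) ?_ ?_ ?_
    · intro x hx
      filter_upwards [ae_restrict_mem measurableSet_Icc] with k hk
      have h1 := hlip p (left_mem_Icc.mpr hpq) x hx k hk
      have hC0 : 0 ≤ C := (abs_nonneg _).trans (hC x hx k hk)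
      have h2 : C * |x - p| ≤ C * (q - p) := by
        rw [abs_of_nonneg (by linarith [hx.1])]
        exact mul_le_mul_of_nonneg_left (by linarith [hx.2]) hC0
      have h3 := abs_add_le (F x k - F p k) (F p k)
      rw [sub_add_cancel] at h3
      rw [Real.norm_eq_abs]
      linarith
    · exact (hI p (left_mem_Icc.mpr hpq)).abs.add (integrable_const _)
    · filter_upwards [ae_restrict_mem measurableSet_Icc] with k hk x hx
      exact (hd x hx k hk).continuousWithinAt
  refine monotoneOn_of_deriv_nonneg (convex_Icc p q) hcont ?_ ?_ (left_mem_Icc.mpr hpq)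
    (right_mem_Icc.mpr hpq) hpq
  · rw [interior_Icc]
    exact fun x hx => (hder x hx).differentiableAt.differentiableWithinAt
  · rw [interior_Icc]
    intro x hx
    rw [(hder x hx).deriv]
    exact h0 x (Ioo_subset_Icc_self hx)

/-- the properties of the evolution used for the time argument -/
structure KinSys (ρ D : ℝ → ℝ → ℝ) (T : ℝ) : Prop where
  hc : ∀ t ∈ Icc 0 T, ContinuousOn (ρ t) (Icc (-1 : ℝ) 1)
  hp : ∀ t ∈ Icc 0 T, ∀ k ∈ Icc (-1 : ℝ) 1, 0 < ρ t k
  hd : ∀ t ∈ Icc 0 T, ∀ k ∈ Icc (-1 : ℝ) 1,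
    HasDerivWithinAt (fun s => ρ s k) (D t k) (Icc 0 T) t
  hl : ∀ t ∈ Icc 0 T, ∀ k ∈ Icc (-1 : ℝ) 1,
    -(2 * (∫ l in Icc (-1 : ℝ) 1, ρ t l) ^ 2) * ρ t k ≤ D t k
  hm : ∀ t ∈ Icc 0 T, ∫ k in Icc (-1 : ℝ) 1, D t k = 0
  he : ∀ t ∈ Icc 0 T, 0 ≤ ∫ k in Icc (-1 : ℝ) 1, D t k / ρ t k
  hb : ∀ R : ℝ, ∃ C : ℝ, ∀ t ∈ Icc 0 T, (∀ k ∈ Icc (-1 : ℝ) 1, ρ t k ≤ R) →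
    ∀ k ∈ Icc (-1 : ℝ) 1, |D t k| ≤ C

variable {ρ D : ℝ → ℝ → ℝ} {T : ℝ}

lemma KinSys.mass_nonneg (h : KinSys ρ D T) {t : ℝ} (ht : t ∈ Icc 0 T) :
    0 ≤ ∫ k in Icc (-1 : ℝ) 1, ρ t k :=
  setIntegral_nonneg measurableSet_Icc fun k hk => (h.hp t ht k hk).le

lemma KinSys.compare (h : KinSys ρ D T) {p q B : ℝ} (h0p : 0 ≤ p) (hqT : q ≤ T)
    (hB : ∀ t ∈ Icc p q, ∫ k in Icc (-1 : ℝ) 1, ρ t k ≤ B) {s t : ℝ} (hs : s ∈ Icc p q)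
    (ht : t ∈ Icc p q) (hst : s ≤ t) {k : ℝ} (hk : k ∈ Icc (-1 : ℝ) 1) :
    Real.exp (2 * B ^ 2 * s) * ρ s k ≤ Real.exp (2 * B ^ 2 * t) * ρ t k := by
  have hsub : Icc p q ⊆ Icc 0 T := Icc_subset_Icc h0p hqT
  have hder : ∀ x ∈ Icc p q, HasDerivWithinAt (fun s => Real.exp (2 * B ^ 2 * s) * ρ s k)
      (Real.exp (2 * B ^ 2 * x) * (2 * B ^ 2) * ρ x k + Real.exp (2 * B ^ 2 * x) * D x k)
      (Icc p q) x := by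
    intro x hx
    have h1 : HasDerivAt (fun s => Real.exp (2 * B ^ 2 * s))
        (Real.exp (2 * B ^ 2 * x) * (2 * B ^ 2)) x := by
      have := ((hasDerivAt_id x).const_mul (2 * B ^ 2)).exp
      simpa using this
    exact h1.hasDerivWithinAt.mul ((h.hd x (hsub hx) k hk).mono hsub)
  refine monotoneOn_of_deriv_nonneg (convex_Icc p q)
    (fun x hx => (hder x hx).continuousWithinAt) ?_ ?_ hs ht hst
  · rw [interior_Icc]
    exact fun x hx => ((hder x (Ioo_subset_Icc_self hx)).hasDerivAt
      (Icc_mem_nhds hx.1 hx.2)).differentiableAt.differentiableWithinAt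
  · rw [interior_Icc]
    intro x hx
    have hx' := Ioo_subset_Icc_self hx
    rw [((hder x hx').hasDerivAt (Icc_mem_nhds hx.1 hx.2)).deriv]
    have h1 := h.hl x (hsub hx') k hk
    have h2 := h.hp x (hsub hx') k hk
    have h3 : (∫ l in Icc (-1 : ℝ) 1, ρ x l) ^ 2 ≤ B ^ 2 :=
      pow_le_pow_left₀ (h.mass_nonneg (hsub hx')) (hB x hx') 2
    have h4 : 0 ≤ (2 * B ^ 2) * ρ x k + D x k := by nlinarith
    have := mul_nonneg (Real.exp_pos (2 * B ^ 2 * x)).le h4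
    linarith

lemma KinSys.upper (h : KinSys ρ D T) {p q B : ℝ} (h0p : 0 ≤ p) (hpq : p ≤ q) (hqT : q ≤ T)
    (hB : ∀ t ∈ Icc p q, ∫ k in Icc (-1 : ℝ) 1, ρ t k ≤ B) :
    ∃ R : ℝ, ∀ t ∈ Icc p q, ∀ k ∈ Icc (-1 : ℝ) 1, ρ t k ≤ R := by
  obtain ⟨M, hM⟩ := isCompact_Icc.exists_bound_of_continuousOn (h.hc q ⟨h0p.trans hpq, hqT⟩)
  refine ⟨Real.exp (2 * B ^ 2 * q) * M, fun t ht k hk => ?_⟩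
  have h1 := h.compare h0p hqT hB ht (right_mem_Icc.mpr hpq) ht.2 hk
  have h2 : 1 ≤ Real.exp (2 * B ^ 2 * t) :=
    Real.one_le_exp (mul_nonneg (by positivity) (h0p.trans ht.1))
  have h3 := h.hp t ⟨h0p.trans ht.1, ht.2.trans hqT⟩ k hk
  have h4 : ρ q k ≤ M := (le_abs_self _).trans (hM k hk)
  calc ρ t k ≤ Real.exp (2 * B ^ 2 * t) * ρ t k := le_mul_of_one_le_left h3.le h2
    _ ≤ _ := h1
    _ ≤ _ := by gcongr

lemma KinSys.lower (h : KinSys ρ D T) {p q B : ℝ} (h0p : 0 ≤ p) (hpq : p ≤ q) (hqT : q ≤ T)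
    (hB : ∀ t ∈ Icc p q, ∫ k in Icc (-1 : ℝ) 1, ρ t k ≤ B) :
    ∃ r : ℝ, 0 < r ∧ ∀ t ∈ Icc p q, ∀ k ∈ Icc (-1 : ℝ) 1, r ≤ ρ t k := by
  have hpT : p ∈ Icc 0 T := ⟨h0p, hpq.trans hqT⟩
  obtain ⟨k0, hk0, hmin⟩ := isCompact_Icc.exists_isMinOn (s := Icc (-1 : ℝ) 1)
    ⟨0, by norm_num⟩ (h.hc p hpT)
  refine ⟨Real.exp (-(2 * B ^ 2 * q)) * ρ p k0, mul_pos (Real.exp_pos _) (h.hp p hpT k0 hk0),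
    fun t ht k hk => ?_⟩
  have h1 := h.compare h0p hqT hB (left_mem_Icc.mpr hpq) ht ht.1 hk
  have h2 : 1 ≤ Real.exp (2 * B ^ 2 * p) :=
    Real.one_le_exp (mul_nonneg (by positivity) h0p)
  have h3 := h.hp t ⟨h0p.trans ht.1, ht.2.trans hqT⟩ k hk
  have h4 : ρ p k0 ≤ ρ p k := hmin hk
  have h5 := h.hp p hpT k hk
  have h6 : Real.exp (2 * B ^ 2 * t) ≤ Real.exp (2 * B ^ 2 * q) :=
    Real.exp_le_exp.mpr (mul_le_mul_of_nonneg_left ht.2 (by positivity))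
  rw [Real.exp_neg, inv_mul_le_iff₀ (Real.exp_pos _)]
  calc ρ p k0 ≤ ρ p k := h4
    _ ≤ Real.exp (2 * B ^ 2 * p) * ρ p k := le_mul_of_one_le_left h5.le h2
    _ ≤ _ := h1
    _ ≤ _ := by gcongr

lemma KinSys.mass_entropy (h : KinSys ρ D T) {p q B : ℝ} (h0p : 0 ≤ p) (hpq : p ≤ q)
    (hqT : q ≤ T) (hB : ∀ t ∈ Icc p q, ∫ k in Icc (-1 : ℝ) 1, ρ t k ≤ B) :
    (∫ k in Icc (-1 : ℝ) 1, ρ p k = ∫ k in Icc (-1 : ℝ) 1, ρ q k) ∧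
    ∫ k in Icc (-1 : ℝ) 1, Real.log (ρ p k) ≤ ∫ k in Icc (-1 : ℝ) 1, Real.log (ρ q k) := by
  have hsub : Icc p q ⊆ Icc 0 T := Icc_subset_Icc h0p hqT
  obtain ⟨R, hR⟩ := h.upper h0p hpq hqT hB
  obtain ⟨r, hr0, hr⟩ := h.lower h0p hpq hqT hB
  obtain ⟨C, hC⟩ := h.hb R
  have hC' : ∀ t ∈ Icc p q, ∀ k ∈ Icc (-1 : ℝ) 1, |D t k| ≤ C :=
    fun t ht k hk => hC t (hsub ht) (hR t ht) k hk
  have hd' : ∀ t ∈ Icc p q, ∀ k ∈ Icc (-1 : ℝ) 1,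
    HasDerivWithinAt (fun s => ρ s k) (D t k) (Icc p q) t :=
    fun t ht k hk => (h.hd t (hsub ht) k hk).mono hsub
  refine ⟨le_antisymm ?_ ?_, ?_⟩
  · exact int_mono_gen hpq (fun t ht => h.hc t (hsub ht)) hd' hC'
      (fun t ht => (h.hm t (hsub ht)).ge)
  · have := int_mono_gen hpq (F := fun t k => - ρ t k) (F' := fun t k => - D t k) (C := C)
      (fun t ht => (h.hc t (hsub ht)).neg) (fun t ht k hk => (hd' t ht k hk).neg)
      (fun t ht k hk => by rw [abs_neg]; exact hC' t ht k hk)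
      (fun t ht => by rw [integral_neg, h.hm t (hsub ht)]; simp)
    rw [integral_neg, integral_neg] at this
    linarith
  · refine int_mono_gen hpq (F := fun t k => Real.log (ρ t k)) (F' := fun t k => D t k / ρ t k)
      (C := C / r) (fun t ht => (h.hc t (hsub ht)).log
        (fun k hk => (h.hp t (hsub ht) k hk).ne')) (fun t ht k hk =>
        (hd' t ht k hk).log (h.hp t (hsub ht) k hk).ne') (fun t ht k hk => ?_)
      (fun t ht => h.he t (hsub ht))
    rw [abs_div, abs_of_pos (h.hp t (hsub ht) k hk)]
    have := hC' t ht k hk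
    exact div_le_div₀ ((abs_nonneg _).trans this) this hr0 (hr t ht k hk)

lemma KinSys.mass_le (h : KinSys ρ D T) {t R : ℝ} (ht : t ∈ Icc 0 T)
    (hR : ∀ k ∈ Icc (-1 : ℝ) 1, ρ t k ≤ R) : ∫ k in Icc (-1 : ℝ) 1, ρ t k ≤ 2 * R := by
  have := setIntegral_mono_on (μ := volume) ((h.hc t ht).integrableOn_compact isCompact_Icc)
    (integrableOn_const (C := R) (μ := volume) (s := Icc (-1 : ℝ) 1) (by simp)) measurableSet_Icc hR
  refine this.trans (le_of_eq ?_)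
  simp
  norm_num

/-- locally bounded near `t` -/
def LocBdd (ρ : ℝ → ℝ → ℝ) (T t : ℝ) : Prop :=
  ∃ R : ℝ, ∀ᶠ s in 𝓝[Icc 0 T] t, ∀ k ∈ Icc (-1 : ℝ) 1, ρ s k ≤ R

lemma KinSys.bdd_of_loc (h : KinSys ρ D T) {p q : ℝ} (h0p : 0 ≤ p)
    (hqT : q ≤ T) (hloc : ∀ t ∈ Icc p q, LocBdd ρ T t) :
    ∃ R : ℝ, ∀ t ∈ Icc p q, ∀ k ∈ Icc (-1 : ℝ) 1, ρ t k ≤ R := by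
  have hsub : Icc p q ⊆ Icc 0 T := Icc_subset_Icc h0p hqT
  refine isCompact_Icc.induction_on (p := fun S => ∃ R : ℝ, ∀ t ∈ S, ∀ k ∈ Icc (-1 : ℝ) 1,
    ρ t k ≤ R) ⟨0, by simp⟩ ?_ ?_ ?_
  · rintro S S' hS ⟨R, hR⟩
    exact ⟨R, fun t ht => hR t (hS ht)⟩
  · rintro S S' ⟨R, hR⟩ ⟨R', hR'⟩
    refine ⟨max R R', ?_⟩
    rintro t (ht | ht) k hk
    · exact (hR t ht k hk).trans (le_max_left _ _)
    · exact (hR' t ht k hk).trans (le_max_right _ _)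
  · intro x hx
    obtain ⟨R, hR⟩ := hloc x hx
    exact ⟨_, nhdsWithin_mono x hsub hR, R, fun t ht => ht⟩

lemma KinSys.mass_gap (h : KinSys ρ D T) {a t : ℝ} (h0a : 0 ≤ a) (hat : a ≤ t) (htT : t ≤ T)
    (hloc : ∀ s ∈ Ioc a t, LocBdd ρ T s) :
    ∫ k in Icc (-1 : ℝ) 1, ρ t k = ∫ k in Icc (-1 : ℝ) 1, ρ a k := by
  have h1 : ∀ s ∈ Ioc a t, ∫ k in Icc (-1 : ℝ) 1, ρ s k = ∫ k in Icc (-1 : ℝ) 1, ρ t k := by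
    intro s hs
    have h0s : 0 ≤ s := h0a.trans hs.1.le
    obtain ⟨R, hR⟩ := h.bdd_of_loc h0s htT
      (fun x hx => hloc x ⟨hs.1.trans_le hx.1, hx.2⟩)
    exact (h.mass_entropy h0s hs.2 htT
      (fun x hx => h.mass_le ⟨h0s.trans hx.1, hx.2.trans htT⟩ (hR x hx))).1
  refine (h.mass_entropy (B := max (∫ k in Icc (-1 : ℝ) 1, ρ t k)
    (∫ k in Icc (-1 : ℝ) 1, ρ a k)) h0a hat htT fun x hx => ?_).1.symm
  rcases hx.1.eq_or_lt with rfl | hlt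
  · exact le_max_right _ _
  · rw [h1 x ⟨hlt, hx.2⟩]; exact le_max_left _ _

lemma KinSys.all_loc (h : KinSys ρ D T) : ∀ t ∈ Icc 0 T, LocBdd ρ T t := by
  set F : Set ℝ := {t | t ∈ Icc 0 T ∧ ¬ LocBdd ρ T t} with hF
  have hFcl : IsClosed F := by
    rw [← isOpen_compl_iff, isOpen_iff_mem_nhds]
    intro x hx
    by_cases hxT : x ∈ Icc 0 T
    · have hl : LocBdd ρ T x := by
        by_contra hn; exact hx ⟨hxT, hn⟩
      obtain ⟨R, hR⟩ := hl
      have h2 := eventually_nhdsWithin_iff.mp (eventually_eventually_nhdsWithin.mpr hR)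
      filter_upwards [h2] with y hy hyF
      exact hyF.2 ⟨R, hy hyF.1⟩
    · filter_upwards [isClosed_Icc.isOpen_compl.mem_nhds hxT] with y hy hyF
      exact hy hyF.1
  by_contra hcon
  push Not at hcon
  obtain ⟨t0, ht0, hnt0⟩ := hcon
  have : Nonempty F := ⟨⟨t0, ht0, hnt0⟩⟩
  have : CompleteSpace F := hFcl.completeSpace_coe
  obtain ⟨N, ⟨s, hsF⟩, hsN⟩ := nonempty_interior_of_iUnion_of_closed
    (f := fun N : ℕ => {t : F | ∀ k ∈ Icc (-1 : ℝ) 1, ρ t k ≤ N}) (by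
      intro N
      have e : {t : F | ∀ k ∈ Icc (-1 : ℝ) 1, ρ t k ≤ N} =
          ⋂ k ∈ Icc (-1 : ℝ) 1, {t : F | ρ t k ≤ N} := by ext; simp
      rw [e]
      refine isClosed_biInter fun k hk => ?_
      have hcont : Continuous (fun t : F => ρ t k) := by
        have : ContinuousOn (fun t => ρ t k) F := fun t ht =>
          ((h.hd t ht.1 k hk).continuousWithinAt).mono (fun y hy => hy.1)
        exact continuousOn_iff_continuous_domRestrict.mp this
      exact isClosed_le hcont continuous_const) (by
      ext t
      simp only [mem_iUnion, mem_setOf_eq, mem_univ, iff_true]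
      obtain ⟨M, hM⟩ := isCompact_Icc.exists_bound_of_continuousOn (h.hc t t.2.1)
      obtain ⟨N, hN⟩ := exists_nat_ge M
      exact ⟨N, fun k hk => (le_abs_self _).trans ((hM k hk).trans hN)⟩)
  rw [mem_interior_iff_mem_nhds, Metric.mem_nhds_iff] at hsN
  obtain ⟨ε, hε, hball⟩ := hsN
  have hN : ∀ t ∈ F, |t - s| < ε → ∀ k ∈ Icc (-1 : ℝ) 1, ρ t k ≤ N := by
    intro t ht hts
    have hmem : (⟨t, ht⟩ : F) ∈ Metric.ball (⟨s, hsF⟩ : F) ε := by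
      rw [Metric.mem_ball, Subtype.dist_eq, Real.dist_eq]; exact hts
    exact hball hmem
  set p := max 0 (s - ε / 2) with hp
  set q := min T (s + ε / 2) with hq
  have h0p : 0 ≤ p := le_max_left _ _
  have hqT : q ≤ T := min_le_left _ _
  have hps : p ≤ s := max_le hsF.1.1 (by linarith)
  have hsq : s ≤ q := le_min hsF.1.2 (by linarith)
  have hnear : ∀ t ∈ Icc p q, |t - s| < ε := by
    intro t ht
    have h1 : s - ε / 2 ≤ t := (le_max_right _ _).trans ht.1
    have h2 : t ≤ s + ε / 2 := ht.2.trans (min_le_right _ _)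
    rw [abs_lt]; constructor <;> linarith
  have hmass : ∀ t ∈ Icc p q, ∫ k in Icc (-1 : ℝ) 1, ρ t k ≤
      max (2 * (N : ℝ)) (∫ k in Icc (-1 : ℝ) 1, ρ p k) := by
    intro t ht
    have htT : t ≤ T := ht.2.trans hqT
    by_cases hne : (F ∩ Icc p t).Nonempty
    · have hcomp : IsCompact (F ∩ Icc p t) := isCompact_Icc.inter_left hFcl
      obtain ⟨a, ⟨haF, hapt⟩, hamax⟩ := hcomp.exists_isGreatest hne
      rw [h.mass_gap haF.1.1 hapt.2 htT]
      · exact (h.mass_le haF.1 (hN a haF (hnear a ⟨hapt.1, hapt.2.trans ht.2⟩))).trans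
          (le_max_left _ _)
      · intro x hx
        by_contra hn
        have hx0 : 0 ≤ x := haF.1.1.trans hx.1.le
        have := hamax ⟨⟨⟨hx0, hx.2.trans htT⟩, hn⟩, ⟨hapt.1.trans hx.1.le, hx.2⟩⟩
        exact absurd hx.1 (not_lt.mpr this)
    · rw [h.mass_gap h0p ht.1 htT]
      · exact le_max_right _ _
      · intro x hx
        by_contra hn
        exact hne ⟨x, ⟨⟨h0p.trans hx.1.le, hx.2.trans htT⟩, hn⟩, hx.1.le, hx.2⟩
  obtain ⟨R, hR⟩ := h.upper h0p (hps.trans hsq) hqT hmass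
  refine hsF.2 ⟨R, ?_⟩
  rw [eventually_nhdsWithin_iff]
  filter_upwards [Ioo_mem_nhds (show s - ε / 2 < s by linarith) (show s < s + ε / 2 by linarith)]
    with y hy hyT
  exact hR y ⟨max_le hyT.1 hy.1.le, le_min hyT.2 hy.2.le⟩

lemma KinSys.entropy (h : KinSys ρ D T) {p : ℝ} (h0p : 0 ≤ p) (hpT : p ≤ T) :
    ∫ k in Icc (-1 : ℝ) 1, Real.log (ρ p k) ≤ ∫ k in Icc (-1 : ℝ) 1, Real.log (ρ T k) := by
  obtain ⟨R, hR⟩ := h.bdd_of_loc h0p le_rfl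
    (fun t ht => h.all_loc t ⟨h0p.trans ht.1, ht.2⟩)
  exact (h.mass_entropy h0p hpT le_rfl
    (fun t ht => h.mass_le ⟨h0p.trans ht.1, ht.2⟩ (hR t ht))).2

end gen

/-- H-theorem: the entropy `∫ log ρ(t,k) dk` is nondecreasing along positive `C¹` solutions of
the kinetic wave equation `∂_t ρ = 𝐂[ρ]` on `[0, T*)`. -/
theorem stmt3 (ν νinv : ℝ → ℝ) (hν : IsNu ν) (hνinv : IsNuInv ν νinv)
    (Tstar : ENNReal) (hT : 0 < Tstar) (ρ : ℝ → ℝ → ℝ)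
    (hcont : ∀ t : ℝ, 0 ≤ t → ENNReal.ofReal t < Tstar →
      ContinuousOn (ρ t) (Set.Icc (-1 : ℝ) 1))
    (hode : ∀ t : ℝ, 0 ≤ t → ENNReal.ofReal t < Tstar → ∀ k ∈ Set.Icc (-1 : ℝ) 1,
      HasDerivWithinAt (fun s => ρ s k) (collision ν νinv (ρ t) k)
        {s : ℝ | 0 ≤ s ∧ ENNReal.ofReal s < Tstar} t)
    (hderivcont : ∀ k ∈ Set.Icc (-1 : ℝ) 1,
      ContinuousOn (fun t => collision ν νinv (ρ t) k)
        {s : ℝ | 0 ≤ s ∧ ENNReal.ofReal s < Tstar})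
    (hpos : ∀ t : ℝ, 0 ≤ t → ENNReal.ofReal t < Tstar → ∀ k ∈ Set.Icc (-1 : ℝ) 1,
      0 < ρ t k) :
    ∀ t₁ : ℝ, 0 ≤ t₁ → ENNReal.ofReal t₁ < Tstar →
      ∀ t₂ : ℝ, 0 ≤ t₂ → ENNReal.ofReal t₂ < Tstar → t₁ ≤ t₂ →
        (∫ k in Set.Icc (-1 : ℝ) 1, Real.log (ρ t₁ k)) ≤
          ∫ k in Set.Icc (-1 : ℝ) 1, Real.log (ρ t₂ k) := by
  intro t₁ h1 _ t₂ h2 h2T h12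
  have hT' : ∀ t ∈ Set.Icc 0 t₂, ENNReal.ofReal t < Tstar :=
    fun t ht => (ENNReal.ofReal_le_ofReal ht.2).trans_lt h2T
  have hbd : ∀ t ∈ Set.Icc 0 t₂, ∃ r R : ℝ, 0 < r ∧
      ∀ k ∈ Set.Icc (-1 : ℝ) 1, r ≤ ρ t k ∧ ρ t k ≤ R := by
    intro t ht
    have hc := hcont t ht.1 (hT' t ht)
    obtain ⟨k0, hk0, hmin⟩ := isCompact_Icc.exists_isMinOn (s := Set.Icc (-1 : ℝ) 1)
      ⟨0, by norm_num⟩ hc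
    obtain ⟨M, hM⟩ := isCompact_Icc.exists_bound_of_continuousOn hc
    exact ⟨ρ t k0, M, hpos t ht.1 (hT' t ht) k0 hk0,
      fun k hk => ⟨hmin hk, (le_abs_self _).trans (hM k hk)⟩⟩
  have hsys : KinSys ρ (fun t k => collision ν νinv (ρ t) k) t₂ :=
    { hc := fun t ht => hcont t ht.1 (hT' t ht)
      hp := fun t ht => hpos t ht.1 (hT' t ht)
      hd := fun t ht k hk => (hode t ht.1 (hT' t ht) k hk).mono (fun s hs => ⟨hs.1, hT' s hs⟩)
      hl := fun t ht k hk => by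
        obtain ⟨r, R, hr, hb⟩ := hbd t ht
        exact coll_lower hν hνinv (hcont t ht.1 (hT' t ht))
          (fun k hk => ⟨hr.le.trans (hb k hk).1, (hb k hk).2⟩) hk
      hm := fun t ht => by
        obtain ⟨r, R, hr, hb⟩ := hbd t ht
        exact coll_mass hν hνinv (hcont t ht.1 (hT' t ht)) hr hb
      he := fun t ht => by
        obtain ⟨r, R, hr, hb⟩ := hbd t ht
        exact coll_entropy hν hνinv (hcont t ht.1 (hT' t ht)) hr hb
      hb := fun R => ⟨_, fun t ht hR k hk =>
        coll_abs hν hνinv (hcont t ht.1 (hT' t ht)) (R := R)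
          (fun k hk => ⟨(hpos t ht.1 (hT' t ht) k hk).le, hR k hk⟩) hk⟩ }
  exact hsys.entropy h1 h12
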